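/- arXiv:2508.08799 — 7 statements merged into one kernel-verified Lean document; each statement's English description precedes it below -/
import Mathlib

section
/- Fix n ≥ 1 and γ ∈ ℝ. For 2×2 matrices P_1, …, P_n, each belonging to {I, σ_x, σ_y, σ_z}, let P be the 2^n × 2^n matrix indexed by functions a, b : Fin n → Fin 2 with entries P(a,b) = Π_{j=1}^n (P_j)_{a_j, b_j} (the n-fold Kronecker/tensor product), and for each site j and μ ∈ {x,y,z} let Σ_{j,μ} be the analogous tensor-product matrix with σ_μ at site j and the identity at all other sites. Let m = #{ j : P_j ≠ I } be the weight of the Pauli string P. Then −(γ/(6n)) Σ_{j=1}^n Σ_{μ∈{x,y,z}} [Σ_{j,μ}, [Σ_{j,μ}, P]] = −(4γ/(3n)) · m · P; that is, every Pauli string is an eigenvector of the n-qubit randomized-measurement Liouvillian with eigenvalue −4γm/(3n). -/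
/-!
STATEMENT 2: every n-qubit Pauli string of weight m is an eigenvector of the
randomized-measurement Liouvillian with eigenvalue −4γm/(3n).
-/

open Matrix

noncomputable def pauliX : Matrix (Fin 2) (Fin 2) ℂ := !![0, 1; 1, 0]
noncomputable def pauliY : Matrix (Fin 2) (Fin 2) ℂ := !![0, -Complex.I; Complex.I, 0]
noncomputable def pauliZ : Matrix (Fin 2) (Fin 2) ℂ := !![1, 0; 0, -1]

noncomputable def pauli : Fin 3 → Matrix (Fin 2) (Fin 2) ℂ
  | 0 => pauliX
  | 1 => pauliY
  | 2 => pauliZ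

/-- The tensor (Kronecker) product matrix of a string of one-qubit matrices:
entries are products of the one-qubit entries. -/
noncomputable def tensorString {n : ℕ} (Q : Fin n → Matrix (Fin 2) (Fin 2) ℂ) :
    Matrix (Fin n → Fin 2) (Fin n → Fin 2) ℂ :=
  Matrix.of fun a b => ∏ j, Q j (a j) (b j)

/-- The single-site Pauli operator `σ_μ` at site `j` (identity elsewhere). -/
noncomputable def siteOp (n : ℕ) (j : Fin n) (μ : Fin 3) :
    Matrix (Fin n → Fin 2) (Fin n → Fin 2) ℂ :=
  tensorString (fun k => if k = j then pauli μ else 1)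

theorem tensorString_mul {n : ℕ} (A B : Fin n → Matrix (Fin 2) (Fin 2) ℂ) :
    tensorString A * tensorString B = tensorString (fun k => A k * B k) := by
  ext a b
  simp only [tensorString, Matrix.mul_apply, Matrix.of_apply]
  rw [Finset.prod_univ_sum]
  simp [Finset.prod_mul_distrib]

theorem tensorString_update_apply {n : ℕ} (P : Fin n → Matrix (Fin 2) (Fin 2) ℂ) (j : Fin n)
    (M : Matrix (Fin 2) (Fin 2) ℂ) (a b : Fin n → Fin 2) :
    tensorString (Function.update P j M) a b
      = M (a j) (b j) * ∏ k ∈ Finset.univ.erase j, P k (a k) (b k) := by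
  simp only [tensorString, Matrix.of_apply]
  rw [← Finset.mul_prod_erase Finset.univ _ (Finset.mem_univ j)]
  congr 1
  · simp
  · refine Finset.prod_congr rfl fun k hk => ?_
    rw [Function.update_of_ne (Finset.ne_of_mem_erase hk)]

/-- Replace site `j` of the string, as a linear map. -/
noncomputable def siteLin {n : ℕ} (P : Fin n → Matrix (Fin 2) (Fin 2) ℂ) (j : Fin n) :
    Matrix (Fin 2) (Fin 2) ℂ →ₗ[ℂ] Matrix (Fin n → Fin 2) (Fin n → Fin 2) ℂ where
  toFun M := tensorString (Function.update P j M)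
  map_add' M N := by
    ext a b
    simp only [Matrix.add_apply, tensorString_update_apply]
    ring
  map_smul' c M := by
    ext a b
    simp only [Matrix.smul_apply, tensorString_update_apply, smul_eq_mul, RingHom.id_apply]
    ring

theorem siteOp_mul_siteLin {n : ℕ} (P : Fin n → Matrix (Fin 2) (Fin 2) ℂ) (j : Fin n)
    (μ : Fin 3) (M : Matrix (Fin 2) (Fin 2) ℂ) :
    siteOp n j μ * siteLin P j M = siteLin P j (pauli μ * M) := by
  simp only [siteOp, siteLin, LinearMap.coe_mk, AddHom.coe_mk, tensorString_mul]
  congr 1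
  funext k
  by_cases h : k = j
  · subst h; simp
  · simp [h]

theorem siteLin_mul_siteOp {n : ℕ} (P : Fin n → Matrix (Fin 2) (Fin 2) ℂ) (j : Fin n)
    (μ : Fin 3) (M : Matrix (Fin 2) (Fin 2) ℂ) :
    siteLin P j M * siteOp n j μ = siteLin P j (M * pauli μ) := by
  simp only [siteOp, siteLin, LinearMap.coe_mk, AddHom.coe_mk, tensorString_mul]
  congr 1
  funext k
  by_cases h : k = j
  · subst h; simp
  · simp [h]

theorem siteLin_self {n : ℕ} (P : Fin n → Matrix (Fin 2) (Fin 2) ℂ) (j : Fin n) :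
    siteLin P j (P j) = tensorString P := by
  simp [siteLin]

theorem pauli_ne_one (ν : Fin 3) : pauli ν ≠ 1 := by
  intro h
  have h0 := congrFun (congrFun h 0) 0
  have h1 := congrFun (congrFun h 1) 1
  fin_cases ν
  · simp [pauli, pauliX] at h0
  · simp [pauli, pauliY] at h0
  · simp [pauli, pauliZ] at h1
    norm_num [Complex.ext_iff] at h1

theorem one_site_pauli (ν : Fin 3) :
    ∑ μ : Fin 3, (pauli μ * (pauli μ * pauli ν - pauli ν * pauli μ)
      - (pauli μ * pauli ν - pauli ν * pauli μ) * pauli μ) = (8 : ℂ) • pauli ν := by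
  rw [Fin.sum_univ_three]
  ext a b
  fin_cases ν <;> fin_cases a <;> fin_cases b <;>
    simp [pauli, pauliX, pauliY, pauliZ, Matrix.mul_apply, Fin.sum_univ_two] <;>
    ring_nf <;> simp <;> ring_nf

open Classical in
theorem one_site (M : Matrix (Fin 2) (Fin 2) ℂ)
    (hM : M = 1 ∨ M = pauli 0 ∨ M = pauli 1 ∨ M = pauli 2) :
    ∑ μ : Fin 3, (pauli μ * (pauli μ * M - M * pauli μ)
      - (pauli μ * M - M * pauli μ) * pauli μ) = (if M ≠ 1 then (8 : ℂ) else 0) • M := by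
  rcases hM with h | h | h | h
  · subst h; simp
  all_goals
    subst h
    rw [one_site_pauli, if_pos (pauli_ne_one _)]

theorem pauli_string_liouvillian_eigenvector (n : ℕ) (hn : 1 ≤ n) (γ : ℝ)
    (Pstr : Fin n → Matrix (Fin 2) (Fin 2) ℂ)
    (hP : ∀ j, Pstr j = 1 ∨ Pstr j = pauli 0 ∨ Pstr j = pauli 1 ∨ Pstr j = pauli 2) :
    (-((γ : ℂ) / (6 * n))) • ∑ j : Fin n, ∑ μ : Fin 3,
        (siteOp n j μ * (siteOp n j μ * tensorString Pstr - tensorString Pstr * siteOp n j μ)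
          - (siteOp n j μ * tensorString Pstr - tensorString Pstr * siteOp n j μ) * siteOp n j μ)
      = (-(4 * (γ : ℂ) * (Nat.card {j : Fin n // Pstr j ≠ 1} : ℂ) / (3 * n))) •
          tensorString Pstr := by
  classical
  have key : ∀ j : Fin n, ∑ μ : Fin 3,
        (siteOp n j μ * (siteOp n j μ * tensorString Pstr - tensorString Pstr * siteOp n j μ)
          - (siteOp n j μ * tensorString Pstr - tensorString Pstr * siteOp n j μ) * siteOp n j μ)
      = (if Pstr j ≠ 1 then (8 : ℂ) else 0) • tensorString Pstr := by
    intro j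
    rw [← siteLin_self Pstr j]
    simp only [siteOp_mul_siteLin, siteLin_mul_siteOp, ← map_sub]
    rw [← map_sum, one_site _ (hP j), map_smul]
  have hn0 : (n : ℂ) ≠ 0 := by
    exact_mod_cast (by omega : n ≠ 0)
  rw [Finset.sum_congr rfl fun j _ => key j, ← Finset.sum_smul, smul_smul]
  congr 1
  rw [← Finset.sum_filter, Finset.sum_const, Nat.card_eq_fintype_card, Fintype.card_subtype,
    nsmul_eq_mul]
  field_simp
  ring
end

section
/- Let n ≥ 1 be a natural number and c_0 ≥ 0, c_2 ≥ 0, c_1, d_0 ∈ ℝ. Let D be the (n+1)×(n+1) real tridiagonal matrix (rows and columns indexed by m = 0,…,n) with D_{m,m} = c_1·m + d_0, D_{m,m+1} = c_2·(n−m), D_{m,m−1} = c_0·m, and all other entries zero. Set Λ_1 = (c_1 + √(c_1² + 4 c_0 c_2))/2 and Λ_2 = (c_1 − √(c_1² + 4 c_0 c_2))/2. Then the characteristic polynomial of D is det(X·I − D) = Π_{p=0}^{n} ( X − d_0 − p·Λ_1 − (n−p)·Λ_2 ); in particular, the eigenvalues of D are equally spaced: λ_p = d_0 + p·Λ_1 +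 (n−p)·Λ_2 for p = 0, 1, …, n. -/
/-!
STATEMENT 4: the characteristic polynomial of the tridiagonal generator D factors as
det(X·I − D) = Π_{p=0}^{n} (X − d0 − p·Λ1 − (n−p)·Λ2), with
Λ_{1,2} = (c1 ± √(c1² + 4c0c2))/2; the eigenvalues of D are equally spaced.
-/

open Matrix Polynomial

/-- entries of the Pascal shift matrix -/
def pasc (t : ℝ) (m k : ℕ) : ℝ := (m.choose k : ℝ) * t ^ (m - k)

lemma pasc_zero_succ (t : ℝ) (k : ℕ) : pasc t 0 (k+1) = 0 := by simp [pasc]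

lemma pasc_mul (t : ℝ) (m k : ℕ) :
    ((m:ℝ) - k) * pasc t m k = t * (k+1) * pasc t m (k+1) := by
  unfold pasc
  rcases lt_trichotomy m k with h | h | h
  · rw [Nat.choose_eq_zero_of_lt h, Nat.choose_eq_zero_of_lt (by omega)]; simp
  · subst h; simp
  · have h1 : (m.choose (k+1) : ℝ) * (k+1) = m.choose k * ((m:ℝ) - k) := by
      rw [← Nat.cast_sub h.le]; exact_mod_cast Nat.choose_succ_right_eq m k
    obtain ⟨d, rfl⟩ := Nat.exists_eq_add_of_lt h
    have e1 : k + d + 1 - k = d + 1 := by omega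
    have e2 : k + d + 1 - (k + 1) = d := by omega
    rw [e1, e2, pow_succ]
    linear_combination (-(t^d*t)) * h1

lemma pasc_succ_succ (t : ℝ) (m k : ℕ) :
    pasc t (m+1) (k+1) = pasc t m k + t * pasc t m (k+1) := by
  unfold pasc
  rw [Nat.choose_succ_succ]
  rcases Nat.lt_or_ge k m with h | h
  · obtain ⟨d, rfl⟩ := Nat.exists_eq_add_of_lt h
    have e1 : k + d + 1 - k = d + 1 := by omega
    have e2 : k + d + 1 - (k + 1) = d := by omega
    have e3 : k + d + 1 + 1 - (k + 1) = d + 1 := by omega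
    rw [e1, e2, e3]; push_cast; ring
  · rw [Nat.choose_eq_zero_of_lt (show m < k+1 by omega)]
    simp

lemma pasc_succ_zero (t : ℝ) (m : ℕ) : pasc t (m+1) 0 = t * pasc t m 0 := by
  simp [pasc, pow_succ, mul_comm]

lemma pasc_absorb (t : ℝ) (m k : ℕ) :
    ((m:ℝ)+1) * pasc t m k = (k+1) * pasc t (m+1) (k+1) := by
  unfold pasc
  have h : ((m:ℝ)+1) * m.choose k = (m+1).choose (k+1) * (k+1) := by
    exact_mod_cast Nat.add_one_mul_choose_eq m k
  rw [Nat.add_sub_add_right]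
  linear_combination t^(m-k) * h

lemma sum_left (n : ℕ) (a b c : ℝ) (m : ℕ) (hm : m ≤ n) (g : ℕ → ℝ) (hb : m = n → b = 0) :
    ∑ j ∈ Finset.range (n+1), (if j = m then a else if j = m+1 then b
      else if j + 1 = m then c else 0) * g j
    = a * g m + b * g (m+1) + (if m = 0 then 0 else c * g (m-1)) := by
  have : ∀ j, (if j = m then a else if j = m+1 then b
      else if j + 1 = m then c else 0) * g j = (if j = m then a * g j else 0)
      + (if j = m+1 then b * g j else 0) + (if j = m - 1 then (if m = 0 then 0 else c * g j) else 0) := by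
    intro j
    split_ifs <;> first | omega | simp
  simp only [this, Finset.sum_add_distrib, Finset.sum_ite_eq', Finset.mem_range]
  rw [if_pos (by omega), if_pos (show m - 1 < n+1 by omega)]
  split_ifs with h
  all_goals first | rfl | (rw [hb (by omega)]; simp)

lemma sum_right (n : ℕ) (a b : ℕ → ℝ) (k : ℕ) (hk : k ≤ n) (g : ℕ → ℝ) :
    ∑ j ∈ Finset.range (n+1), g j * (if k = j then a j else if k = j+1 then b j else 0)
    = g k * a k + (if k = 0 then 0 else g (k-1) * b (k-1)) := by
  have : ∀ j, g j * (if k = j then a j else if k = j+1 then b j else 0)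
     = (if j = k then g j * a j else 0)
      + (if j = k - 1 then (if k = 0 then 0 else g j * b j) else 0) := by
    intro j
    split_ifs <;> first | omega | simp
  simp only [this, Finset.sum_add_distrib, Finset.sum_ite_eq', Finset.mem_range]
  rw [if_pos (by omega), if_pos (show k - 1 < n+1 by omega)]

lemma key (n m k : ℕ) (c0 c1 c2 d0 t : ℝ) (ht : c0 + c1 * t - c2 * t^2 = 0) :
    (c1 * m + d0) * pasc t m k + c2 * ((n:ℝ) - m) * pasc t (m+1) k
      + (if m = 0 then 0 else c0 * m * pasc t (m-1) k)
    = pasc t m k * (d0 + c2 * n * t + (c1 - 2 * c2 * t) * k)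
      + (if k = 0 then 0 else pasc t m (k-1) * (c2 * ((n:ℝ) - (k-1:ℕ)))) := by
  have h1 : (if m = 0 then 0 else c0 * m * pasc t (m-1) k) = c0 * ((k+1) * pasc t m (k+1)) := by
    rcases m with _ | m
    · simp [pasc_zero_succ]
    · have := pasc_absorb t m k
      simp only [Nat.add_sub_cancel, Nat.add_eq_zero_iff, one_ne_zero, and_false, if_false]
      push_cast
      linear_combination c0 * this
  rw [h1]
  have h2 := pasc_mul t m k
  rcases k with _ | k
  · rw [pasc_succ_zero]
    simp only [if_true]
    push_cast at h2 ⊢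
    linear_combination (c1 - c2 * t) * h2 + pasc t m (0+1) * ht
  · have h3 := pasc_mul t m k
    rw [pasc_succ_succ]
    simp only [Nat.add_sub_cancel, Nat.add_eq_zero_iff, one_ne_zero, and_false, if_false]
    push_cast at h2 ⊢
    linear_combination (c1 - c2 * t) * h2 + (k+1+1) * pasc t m (k+1+1) * ht - c2 * h3

lemma charpoly_sim {N : ℕ} (A B P : Matrix (Fin N) (Fin N) ℝ) (hP : P.det = 1)
    (h : A * P = P * B) : A.charpoly = B.charpoly := by
  have hu : IsUnit P.det := by rw [hP]; exact isUnit_one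
  have hA : A = P * B * P⁻¹ := by
    rw [← h, Matrix.mul_assoc, Matrix.mul_nonsing_inv _ hu, Matrix.mul_one]
  rw [hA, Matrix.charpoly_mul_comm, ← Matrix.mul_assoc, Matrix.nonsing_inv_mul _ hu, Matrix.one_mul]

theorem tridiagonal_charpoly (n : ℕ) (hn : 1 ≤ n) (c0 c2 c1 d0 : ℝ)
    (hc0 : 0 ≤ c0) (hc2 : 0 ≤ c2)
    (D : Matrix (Fin (n + 1)) (Fin (n + 1)) ℝ)
    (hD : D = Matrix.of fun (m k : Fin (n + 1)) =>
      if (k : ℕ) = (m : ℕ) then c1 * ((m : ℕ) : ℝ) + d0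
      else if (k : ℕ) = (m : ℕ) + 1 then c2 * ((n : ℝ) - ((m : ℕ) : ℝ))
      else if (k : ℕ) + 1 = (m : ℕ) then c0 * ((m : ℕ) : ℝ)
      else 0) :
    D.charpoly = ∏ p ∈ Finset.range (n + 1),
      (Polynomial.X - Polynomial.C (d0
        + (p : ℝ) * ((c1 + Real.sqrt (c1 ^ 2 + 4 * c0 * c2)) / 2)
        + ((n : ℝ) - (p : ℝ)) * ((c1 - Real.sqrt (c1 ^ 2 + 4 * c0 * c2)) / 2))) := by
  set s := Real.sqrt (c1 ^ 2 + 4 * c0 * c2) with hs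
  have hs2 : s ^ 2 = c1 ^ 2 + 4 * c0 * c2 := Real.sq_sqrt (by positivity)
  by_cases h2 : c2 = 0
  · have hT : (Dᵀ).BlockTriangular id := by
      intro i j hij
      have hij' : (j:ℕ) < i := hij
      subst hD
      simp only [Matrix.transpose_apply, Matrix.of_apply, h2, zero_mul]
      split_ifs <;> first | omega | rfl
    rw [← Matrix.charpoly_transpose, Matrix.charpoly_of_upperTriangular _ hT]
    have hd : ∀ i : Fin (n+1), Dᵀ i i = c1 * ((i:ℕ):ℝ) + d0 := by
      intro i; subst hD; simp
    simp only [hd]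
    rw [Fin.prod_univ_eq_prod_range (fun i : ℕ => X - C (c1 * (i:ℝ) + d0))]
    have : (s - c1) * (s + c1) = 0 := by rw [h2] at hs2; linear_combination hs2
    rcases mul_eq_zero.mp this with h | h
    · have : s = c1 := by linarith
      rw [this]
      refine Finset.prod_congr rfl fun p _ => ?_
      congr 2; ring
    · have : s = -c1 := by linarith
      rw [this, ← Finset.prod_range_reflect]
      refine Finset.prod_congr rfl fun p hp => ?_
      have hp := Finset.mem_range.mp hp
      rw [show n + 1 - 1 - p = n - p by omega, Nat.cast_sub (by omega)]
      congr 2; ring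
  · obtain ⟨t, ht⟩ : ∃ t, c2 * t = (c1 + s) / 2 := ⟨(c1 + s) / 2 / c2, by field_simp⟩
    have hroot : c0 + c1 * t - c2 * t^2 = 0 := by
      apply mul_left_cancel₀ h2
      have e : c2 * (c0 + c1 * t - c2 * t^2) = c2 * c0 + c1 * (c2 * t) - (c2 * t)^2 := by ring
      rw [e, ht]
      linear_combination (-1/4) * hs2
    let P : Matrix (Fin (n+1)) (Fin (n+1)) ℝ := Matrix.of fun m k => pasc t m k
    let T : Matrix (Fin (n+1)) (Fin (n+1)) ℝ := Matrix.of fun j k =>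
      if (k:ℕ) = (j:ℕ) then d0 + c2 * n * t + (c1 - 2 * c2 * t) * ((j:ℕ):ℝ)
      else if (k:ℕ) = (j:ℕ) + 1 then c2 * ((n:ℝ) - ((j:ℕ):ℝ)) else 0
    have hP : P.det = 1 := by
      have : P.BlockTriangular OrderDual.toDual := by
        intro i j hij
        have hij' : (i:ℕ) < j := hij
        simp [P, pasc, Nat.choose_eq_zero_of_lt hij']
      rw [Matrix.det_of_lowerTriangular _ this]
      simp [P, pasc]
    have hDP : D * P = P * T := by
      ext m k
      rw [Matrix.mul_apply, Matrix.mul_apply, hD]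
      simp only [P, T, Matrix.of_apply]
      have hm : (m:ℕ) ≤ n := by omega
      have hk : (k:ℕ) ≤ n := by omega
      have l := sum_left n (c1 * ((m : ℕ) : ℝ) + d0) (c2 * ((n : ℝ) - ((m : ℕ) : ℝ)))
        (c0 * ((m : ℕ) : ℝ)) m hm (fun j => pasc t j k) (by intro h; rw [h]; simp)
      have r := sum_right n (fun j => d0 + c2 * n * t + (c1 - 2 * c2 * t) * (j:ℝ))
        (fun j => c2 * ((n:ℝ) - (j:ℝ))) k hk (fun j => pasc t m j)
      rw [← Fin.sum_univ_eq_sum_range] at l r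
      rw [l, r]
      exact key n m k c0 c1 c2 d0 t hroot
    rw [charpoly_sim D T P hP hDP]
    have hT : T.BlockTriangular id := by
      intro i j hij
      have hij' : (j:ℕ) < i := hij
      simp only [T, Matrix.of_apply]
      split_ifs <;> first | omega | rfl
    rw [Matrix.charpoly_of_upperTriangular _ hT]
    simp only [T, Matrix.of_apply, if_true]
    rw [Fin.prod_univ_eq_prod_range (fun i : ℕ =>
      X - C (d0 + c2 * n * t + (c1 - 2 * c2 * t) * (i:ℝ))), ← Finset.prod_range_reflect]
    refine Finset.prod_congr rfl fun p hp => ?_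
    have hp := Finset.mem_range.mp hp
    rw [show n + 1 - 1 - p = n - p by omega, Nat.cast_sub (by omega)]
    congr 2
    linear_combination (n - 2 * ((n:ℝ) - p)) * ht
end

section
/- Let n ≥ 1 be a natural number and γ > 0. Define w_0(t) = (3·e^{4γt/(3n)} + e^{−4γt/n})^n and, for 0 ≤ m ≤ n, w_m(t) = w_0(t) · ( (1 − e^{−16γt/(3n)}) / (3 + e^{−16γt/(3n)}) )^m, with the convention w_{−1} = w_{n+1} = 0. Then for every real t and every 0 ≤ m ≤ n, the functions w_m are differentiable and satisfy the coupled linear ODE system d w_m/dt = −(8m/(3n))·γ·w_m + (4m/(3n))·γ·w_{m−1} + (4(n−m)/n)·γ·w_{m+1}. (Equivalently, w_m(t) = (3e^{u} + e^{−3u})^{n−m} · (e^{u} − e^{−3u})^{m} with u = 4γt/(3n).) -/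
/-!
STATEMENT 5: the Pauli weights
w_m(t) = (3e^{4γt/(3n)} + e^{−4γt/n})^n · ((1 − e^{−16γt/(3n)})/(3 + e^{−16γt/(3n)}))^m,
with the convention w_{−1} = w_{n+1} = 0, satisfy the coupled linear ODE system
dw_m/dt = −(8m/(3n))γ·w_m + (4m/(3n))γ·w_{m−1} + (4(n−m)/n)γ·w_{m+1}.
-/

theorem pauli_weight_ode (n : ℕ) (hn : 1 ≤ n) (γ : ℝ) (hγ : 0 < γ)
    (w : ℤ → ℝ → ℝ)
    (hw : w = fun m t =>
      if 0 ≤ m ∧ m ≤ (n : ℤ) then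
        (3 * Real.exp (4 * γ * t / (3 * n)) + Real.exp (-(4 * γ * t / n))) ^ n *
          ((1 - Real.exp (-(16 * γ * t / (3 * n)))) /
            (3 + Real.exp (-(16 * γ * t / (3 * n))))) ^ m.toNat
      else 0) :
    ∀ m : ℤ, 0 ≤ m → m ≤ (n : ℤ) → ∀ t : ℝ,
      HasDerivAt (w m)
        (-(8 * (m : ℝ) / (3 * n)) * γ * w m t
          + (4 * (m : ℝ) / (3 * n)) * γ * w (m - 1) t
          + (4 * ((n : ℝ) - (m : ℝ)) / n) * γ * w (m + 1) t) t := by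
  subst hw
  intro m hm0 hmn t
  obtain ⟨k, rfl⟩ := Int.eq_ofNat_of_zero_le hm0
  have hkn : k ≤ n := by exact_mod_cast hmn
  have hn0 : (n : ℝ) ≠ 0 := by
    have : n ≠ 0 := by omega
    exact_mod_cast this
  set A : ℝ → ℝ := fun t => 3 * Real.exp (4 * γ * t / (3 * n)) + Real.exp (-(4 * γ * t / n)) with hA
  set r : ℝ → ℝ := fun t => (1 - Real.exp (-(16 * γ * t / (3 * n)))) /
            (3 + Real.exp (-(16 * γ * t / (3 * n)))) with hr
  have hlin : ∀ c d : ℝ, HasDerivAt (fun t : ℝ => c * t / d) (c / d) t := by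
    intro c d
    simpa using ((hasDerivAt_id t).const_mul c).div_const d
  have hE := (hlin (16 * γ) (3 * n)).neg.exp
  have hpos : 3 + Real.exp (-(16 * γ * t / (3 * n))) ≠ 0 := by positivity
  have hr' : HasDerivAt r (4 * γ / (3 * n) * (1 - 2 * r t - 3 * r t ^ 2)) t := by
    refine ((hE.const_sub 1).div (hE.const_add 3) hpos).congr_deriv ?_
    simp only [hr, Pi.neg_apply]
    generalize Real.exp (-(16 * γ * t / (3 * n))) = E at hpos
    field_simp
    ring
  have hA' : HasDerivAt A (4 * γ / n * (r t * A t)) t := by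
    refine (((hlin (4 * γ) (3 * n)).exp.const_mul 3).add (hlin (4 * γ) n).neg.exp).congr_deriv ?_
    have hXE : Real.exp (-(4 * γ * t / n)) =
        Real.exp (4 * γ * t / (3 * n)) * Real.exp (-(16 * γ * t / (3 * n))) := by
      rw [← Real.exp_add]
      congr 1
      field_simp
      ring
    simp only [hr, hA, Pi.neg_apply, hXE]
    generalize Real.exp (-(16 * γ * t / (3 * n))) = E at hpos
    generalize Real.exp (4 * γ * t / (3 * n)) = X
    field_simp
    ring
  have hAn : HasDerivAt (fun t => A t ^ n) (4 * γ * r t * A t ^ n) t := by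
    refine (hA'.pow n).congr_deriv ?_
    obtain ⟨j, rfl⟩ : ∃ j, n = j + 1 := ⟨n - 1, by omega⟩
    simp only [Nat.add_sub_cancel]
    field_simp
    ring
  have hw : HasDerivAt (fun t => A t ^ n * r t ^ k)
      (4 * γ * r t * A t ^ n * r t ^ k + A t ^ n *
        (k * r t ^ (k - 1) * (4 * γ / (3 * n) * (1 - 2 * r t - 3 * r t ^ 2)))) t :=
    hAn.mul (hr'.pow k)
  have hfun : (fun t => if 0 ≤ (k : ℤ) ∧ (k : ℤ) ≤ (n : ℤ) then
      A t ^ n * r t ^ (k : ℤ).toNat else 0) = fun t => A t ^ n * r t ^ k := by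
    funext s
    rw [if_pos ⟨hm0, hmn⟩, Int.toNat_natCast]
  have h1 : (k : ℝ) * (if 0 ≤ (k : ℤ) - 1 ∧ (k : ℤ) - 1 ≤ (n : ℤ) then
      A t ^ n * r t ^ ((k : ℤ) - 1).toNat else 0) = k * (A t ^ n * r t ^ (k - 1)) := by
    rcases Nat.eq_zero_or_pos k with h | h
    · simp [h]
    · rw [if_pos (by omega), show ((k : ℤ) - 1).toNat = k - 1 by omega]
  have h2 : ((n : ℝ) - k) * (if 0 ≤ (k : ℤ) + 1 ∧ (k : ℤ) + 1 ≤ (n : ℤ) then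
      A t ^ n * r t ^ ((k : ℤ) + 1).toNat else 0) = (n - k) * (A t ^ n * r t ^ (k + 1)) := by
    rcases hkn.eq_or_lt with h | h
    · simp [h]
    · rw [if_pos (by omega), show ((k : ℤ) + 1).toNat = k + 1 by omega]
  have h0 : (k : ℝ) * r t ^ k = k * (r t ^ (k - 1) * r t) := by
    rcases Nat.eq_zero_or_pos k with h | h
    · simp [h]
    · rw [← pow_succ, Nat.sub_add_cancel h]
  change HasDerivAt (fun t => if 0 ≤ (k : ℤ) ∧ (k : ℤ) ≤ (n : ℤ) then
      A t ^ n * r t ^ (k : ℤ).toNat else 0)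
    (-(8 * (((k : ℕ) : ℤ) : ℝ) / (3 * n)) * γ * (if 0 ≤ (k : ℤ) ∧ (k : ℤ) ≤ (n : ℤ) then
      A t ^ n * r t ^ (k : ℤ).toNat else 0)
      + (4 * (((k : ℕ) : ℤ) : ℝ) / (3 * n)) * γ *
        (if 0 ≤ (k : ℤ) - 1 ∧ (k : ℤ) - 1 ≤ (n : ℤ) then
          A t ^ n * r t ^ ((k : ℤ) - 1).toNat else 0)
      + (4 * ((n : ℝ) - (((k : ℕ) : ℤ) : ℝ)) / n) * γ *
        (if 0 ≤ (k : ℤ) + 1 ∧ (k : ℤ) + 1 ≤ (n : ℤ) then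
          A t ^ n * r t ^ ((k : ℤ) + 1).toNat else 0)) t
  rw [hfun]
  refine hw.congr_deriv ?_
  rw [if_pos ⟨hm0, hmn⟩, Int.toNat_natCast, Int.cast_natCast]
  generalize (if 0 ≤ (k : ℤ) - 1 ∧ (k : ℤ) - 1 ≤ (n : ℤ) then
      A t ^ n * r t ^ ((k : ℤ) - 1).toNat else 0) = P at h1 ⊢
  generalize (if 0 ≤ (k : ℤ) + 1 ∧ (k : ℤ) + 1 ≤ (n : ℤ) then
      A t ^ n * r t ^ ((k : ℤ) + 1).toNat else 0) = Q at h2 ⊢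
  have e1 : -(8 * (k : ℝ) / (3 * n)) * γ * (A t ^ n * r t ^ k) + 4 * (k : ℝ) / (3 * n) * γ * P
      + 4 * ((n : ℝ) - k) / n * γ * Q
      = -(8 / (3 * n)) * γ * A t ^ n * (k * r t ^ k) + 4 / (3 * n) * γ * (k * P)
        + 4 / n * γ * (((n : ℝ) - k) * Q) := by ring
  have e2 : ((n : ℝ) - k) * (A t ^ n * r t ^ (k + 1))
      = A t ^ n * r t * (n * r t ^ k - k * r t ^ k) := by ring
  rw [e1, h1, h2, e2, h0]
  generalize A t ^ n = a
  generalize r t ^ k = b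
  generalize r t ^ (k - 1) = c
  generalize r t = x
  field_simp
  ring
end

section
/- Let n ≥ 1 be a natural number and γ > 0. Let D be the (n+1)×(n+1) real tridiagonal matrix (rows and columns indexed by m = 0,…,n) with D_{m,m} = −8γm/(3n), D_{m,m−1} = 4γm/(3n), D_{m,m+1} = 4γ(n−m)/n, and all other entries zero. Then the characteristic polynomial of D is det(X·I − D) = Π_{p=0}^{n} ( X − 4γ/3 + (16γ/(3n))·p ); in particular, the eigenvalues of D are λ_p = 4γ/3 − (16γ/(3n))·p for p = 0, 1, …, n. -/
open Matrix Polynomial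

/-- entries of the signed Pascal matrix -/
noncomputable def pwP (m k : ℕ) : ℝ := (-1) ^ (m + k) * (m.choose k : ℝ)

lemma pwP_succ_succ (m k : ℕ) : pwP (m + 1) (k + 1) = pwP m k - pwP m (k + 1) := by
  unfold pwP
  rw [Nat.choose_succ_succ]
  push_cast
  ring

lemma pwP_succ_zero (m : ℕ) : pwP (m + 1) 0 = - pwP m 0 := by
  unfold pwP
  simp [pow_succ]

lemma pwP_right (m k : ℕ) : ((m : ℝ) - k) * pwP m k = -((k : ℝ) + 1) * pwP m (k + 1) := by
  unfold pwP
  have h : ((m.choose (k + 1) : ℕ) : ℝ) * (k + 1) = (m.choose k : ℝ) * ((m : ℝ) - k) := by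
    rcases le_total k m with hk | hk
    · have := Nat.choose_succ_right_eq m k
      rw [← Nat.cast_sub hk]
      exact_mod_cast this
    · rcases hk.eq_or_lt with rfl | hk
      · simp
      · simp [Nat.choose_eq_zero_of_lt hk, Nat.choose_eq_zero_of_lt (Nat.lt_succ_of_lt hk)]
  rw [← add_assoc, pow_succ]
  linear_combination (-(-1 : ℝ) ^ (m + k)) * h

lemma pwP_left (m k : ℕ) : ((m : ℝ) + 1 - k) * pwP (m + 1) k = -((m : ℝ) + 1) * pwP m k := by
  cases k with
  | zero => rw [pwP_succ_zero]; push_cast; ring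
  | succ k =>
    have h1 := pwP_right m k
    rw [pwP_succ_succ]
    push_cast
    linear_combination h1

lemma pw_key (n : ℝ) (m k : ℕ) :
    -2 * (m : ℝ) * pwP m k + m * pwP (m - 1) k + 3 * (n - m) * pwP (m + 1) k
      = (4 * k - 3 * n) * pwP m k + (if k = 0 then 0 else 3 * (n - k + 1) * pwP m (k - 1)) := by
  have hl : ((m : ℝ) - k) * pwP m k = -(m : ℝ) * pwP (m - 1) k := by
    cases m with
    | zero => cases k <;> simp [pwP]
    | succ m => have := pwP_left m k; push_cast; simpa using this
  cases k with
  | zero =>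
    rw [pwP_succ_zero]
    push_cast at hl ⊢
    try simp only [if_true]
    linear_combination hl
  | succ k =>
    have h1 := pwP_right m k
    rw [pwP_succ_succ]
    push_cast at hl h1 ⊢
    try simp only [Nat.add_sub_cancel, Nat.succ_ne_zero, if_false]
    linear_combination hl - 3 * h1

lemma pw_sum_row (n m : ℕ) (hm : m ≤ n) (a b c : ℝ) (hb : m = 0 → b = 0) (hc : m = n → c = 0)
    (f : ℕ → ℝ) :
    ∑ k : Fin (n + 1), (if (k : ℕ) = m then a else if (k : ℕ) + 1 = m then b
      else if (k : ℕ) = m + 1 then c else 0) * f k = a * f m + b * f (m - 1) + c * f (m + 1) := by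
  rw [Fin.sum_univ_eq_sum_range (fun k => (if k = m then a else if k + 1 = m then b
      else if k = m + 1 then c else 0) * f k)]
  have : ∀ k ∈ Finset.range (n + 1), (if k = m then a else if k + 1 = m then b
      else if k = m + 1 then c else 0) * f k = (if k = m then a * f m else 0)
      + (if k = m - 1 then b * f (m - 1) else 0) + (if k = m + 1 then c * f (m + 1) else 0) := by
    intro k hk
    by_cases h1 : k = m
    · subst h1
      by_cases h0 : k = 0
      · simp [h0, hb h0]
      · have : k ≠ k - 1 := by omega
        simp [this]
    · by_cases h2 : k + 1 = m
      · subst h2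
        have : k ≠ k + 1 + 1 := by omega
        simp [this]
      · by_cases h3 : k = m + 1
        · subst h3
          have : m + 1 ≠ m - 1 := by omega
          simp [this]
          omega
        · simp only [h1, h2, h3, if_false]
          by_cases h0 : m = 0
          · simp [hb h0]
          · have : k ≠ m - 1 := by omega
            simp [this]
  rw [Finset.sum_congr rfl this]
  simp only [Finset.sum_add_distrib, Finset.sum_ite_eq', Finset.mem_range]
  have e1 : m < n + 1 := by omega
  have e2 : m - 1 < n + 1 := by omega
  simp only [e1, e2, if_true]
  by_cases h : m = n
  · simp [hc h]
  · have e3 : m + 1 < n + 1 := by omega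
    simp [e3]

lemma pw_sum_col (n k : ℕ) (hk : k ≤ n) (a c : ℕ → ℝ) (f : ℕ → ℝ) :
    ∑ j : Fin (n + 1), f j * (if (j : ℕ) = k then a j else if (j : ℕ) + 1 = k then c j else 0)
      = f k * a k + (if k = 0 then 0 else f (k - 1) * c (k - 1)) := by
  rw [Fin.sum_univ_eq_sum_range (fun j => f j * (if j = k then a j else
    if j + 1 = k then c j else 0))]
  have : ∀ j ∈ Finset.range (n + 1), f j * (if j = k then a j else
      if j + 1 = k then c j else 0) = (if j = k then f k * a k else 0)
      + (if j = k - 1 then (if k = 0 then 0 else f (k - 1) * c (k - 1)) else 0) := by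
    intro j _
    by_cases h1 : j = k
    · subst h1
      by_cases h0 : j = 0
      · simp [h0]
      · have : j ≠ j - 1 := by omega
        simp [this]
    · by_cases h2 : j + 1 = k
      · subst h2
        simp
      · by_cases h0 : k = 0
        · simp [h0] at *
          simp [h1]
        · have : j ≠ k - 1 := by omega
          simp [h1, h2, this]
  rw [Finset.sum_congr rfl this]
  simp only [Finset.sum_add_distrib, Finset.sum_ite_eq', Finset.mem_range]
  have e1 : k < n + 1 := by omega
  have e2 : k - 1 < n + 1 := by omega
  simp only [e1, e2, if_true]

lemma pw_charpoly_of_conj {ι : Type*} [Fintype ι] [DecidableEq ι] (A B P : Matrix ι ι ℝ)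
    (hP : P.det = 1) (h : A * P = P * B) : A.charpoly = B.charpoly := by
  have hu : IsUnit P := by
    rw [Matrix.isUnit_iff_isUnit_det, hP]; exact isUnit_one
  obtain ⟨U, rfl⟩ := hu
  have : A = U.val * B * U⁻¹.val := by
    rw [← h, mul_assoc, Units.mul_inv, mul_one]
  rw [this]
  simpa using Matrix.charpoly_units_conj U B

theorem pauli_weight_generator_charpoly (n : ℕ) (hn : 1 ≤ n) (γ : ℝ) (hγ : 0 < γ)
    (D : Matrix (Fin (n + 1)) (Fin (n + 1)) ℝ)
    (hD : D = Matrix.of fun (m k : Fin (n + 1)) =>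
      if (k : ℕ) = (m : ℕ) then -(8 * γ * ((m : ℕ) : ℝ) / (3 * n))
      else if (k : ℕ) + 1 = (m : ℕ) then 4 * γ * ((m : ℕ) : ℝ) / (3 * n)
      else if (k : ℕ) = (m : ℕ) + 1 then 4 * γ * ((n : ℝ) - ((m : ℕ) : ℝ)) / n
      else 0) :
    D.charpoly = ∏ p ∈ Finset.range (n + 1),
      (Polynomial.X - Polynomial.C (4 * γ / 3 - (16 * γ / (3 * n)) * (p : ℝ))) := by
  have hn0 : (n : ℝ) ≠ 0 := by positivity
  set P : Matrix (Fin (n + 1)) (Fin (n + 1)) ℝ := Matrix.of fun m k => pwP m k with hPdef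
  set B : Matrix (Fin (n + 1)) (Fin (n + 1)) ℝ := Matrix.of fun j k =>
    if (j : ℕ) = (k : ℕ) then 4 * γ / (3 * n) * (4 * ((j : ℕ) : ℝ) - 3 * n)
    else if (j : ℕ) + 1 = (k : ℕ) then 4 * γ / (3 * n) * (3 * ((n : ℝ) - ((j : ℕ) : ℝ)))
    else 0 with hBdef
  have hP : P.det = 1 := by
    rw [Matrix.det_of_lowerTriangular]
    · apply Finset.prod_eq_one
      intro i _
      simp [hPdef, pwP, ← two_mul]
    · intro i j hij
      have : (i : ℕ) < j := by simpa using hij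
      simp [hPdef, pwP, Nat.choose_eq_zero_of_lt this]
  have hconj : D * P = P * B := by
    ext m k
    rw [hD, Matrix.mul_apply, Matrix.mul_apply]
    simp only [hPdef, hBdef, Matrix.of_apply]
    have hmn : (m : ℕ) ≤ n := Nat.lt_succ_iff.mp m.2
    have hkn : (k : ℕ) ≤ n := Nat.lt_succ_iff.mp k.2
    rw [pw_sum_row n m hmn _ _ _ (by intro h; simp [h]) (by intro h; simp [h])
      (fun j => pwP j k)]
    rw [pw_sum_col n k hkn (fun j => 4 * γ / (3 * n) * (4 * (j : ℝ) - 3 * n))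
      (fun j => 4 * γ / (3 * n) * (3 * ((n : ℝ) - (j : ℝ)))) (fun j => pwP m j)]
    have key := pw_key (n : ℝ) m k
    have e : (4 * γ * ((n : ℝ) - ((m : ℕ) : ℝ)) / n)
        = 4 * γ / (3 * n) * (3 * ((n : ℝ) - ((m : ℕ) : ℝ))) := by
      field_simp
    rw [e]
    by_cases h0 : (k : ℕ) = 0
    · simp only [h0, if_true] at *
      linear_combination (4 * γ / (3 * n)) * key
    · have hk1 : 1 ≤ (k : ℕ) := Nat.one_le_iff_ne_zero.mpr h0
      simp only [h0, if_false] at key ⊢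
      have : (((k : ℕ) - 1 : ℕ) : ℝ) = ((k : ℕ) : ℝ) - 1 := by
        rw [Nat.cast_sub hk1]; simp
      rw [this]
      linear_combination (4 * γ / (3 * n)) * key
  rw [pw_charpoly_of_conj D B P hP hconj, Matrix.charpoly_of_upperTriangular]
  · rw [← Finset.prod_range_reflect]
    rw [← Fin.prod_univ_eq_prod_range (fun j => (X - C (4 * γ / 3 - (16 * γ / (3 * n)) *
      ((n + 1 - 1 - j : ℕ) : ℝ))) ) (n + 1)]
    apply Finset.prod_congr rfl
    intro i _
    have hi : (i : ℕ) ≤ n := Nat.lt_succ_iff.mp i.2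
    congr 2
    simp only [hBdef, Matrix.of_apply, if_true, Nat.add_sub_cancel]
    rw [Nat.cast_sub hi]
    field_simp
    ring
  · intro i j hij
    have : (j : ℕ) < i := by simpa using hij
    have h1 : (i : ℕ) ≠ j := by omega
    have h2 : (i : ℕ) + 1 ≠ j := by omega
    simp [hBdef, h1, h2]
end

section
/- Quantitative core of the Distribution Convergence Theorem: let L > 0, 0 < ε < 1, 0 < C < 1, E ≥ 0, dt > 0 and N a natural number with N·dt = T := (C/L)·ln(1/ε). Suppose a_0, a_1, …, a_N are nonnegative reals satisfying a_k ≤ (1 + L·dt)·a_{k+1} + √2·ε·dt for all 0 ≤ k < N, and a_N ≤ E. Then a_0 ≤ (√2/L)·ε^{1−C} + ε^{−C}·E. -/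
/-!
STATEMENT 8: quantitative core of the Distribution Convergence Theorem: with
stopping time T = N·dt = (C/L)·ln(1/ε) and per-step error √2·ε·dt, the
Wasserstein recursion gives a_0 ≤ (√2/L)·ε^{1−C} + ε^{−C}·E.
-/

theorem distribution_convergence_core (L ε C E dt : ℝ) (N : ℕ)
    (hL : 0 < L) (hε0 : 0 < ε) (hε1 : ε < 1) (hC0 : 0 < C) (hC1 : C < 1)
    (hE : 0 ≤ E) (hdt : 0 < dt)
    (hT : (N : ℝ) * dt = (C / L) * Real.log (1 / ε))
    (a : ℕ → ℝ) (ha : ∀ k ≤ N, 0 ≤ a k)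
    (hrec : ∀ k < N, a k ≤ (1 + L * dt) * a (k + 1) + Real.sqrt 2 * ε * dt)
    (haN : a N ≤ E) :
    a 0 ≤ (Real.sqrt 2 / L) * ε ^ (1 - C) + ε ^ (-C) * E := by
  obtain ⟨s, hs⟩ : ∃ s, s = Real.sqrt 2 * ε / L := ⟨_, rfl⟩
  have hs0 : 0 ≤ s := by rw [hs]; positivity
  have hsL : L * s = Real.sqrt 2 * ε := by rw [hs]; field_simp
  have hq : 0 < 1 + L * dt := by positivity
  have key : ∀ k ≤ N, a 0 + s ≤ (1 + L * dt) ^ k * (a k + s) := by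
    intro k
    induction k with
    | zero => intro _; simp
    | succ k ih =>
      intro hk
      have h1 := ih (by omega)
      have h2 := hrec k (by omega)
      have h3 : a k + s ≤ (1 + L * dt) * (a (k + 1) + s) := by
        have : (1 + L * dt) * s = s + Real.sqrt 2 * ε * dt := by rw [← hsL]; ring
        linarith
      calc a 0 + s ≤ (1 + L * dt) ^ k * (a k + s) := h1
        _ ≤ (1 + L * dt) ^ k * ((1 + L * dt) * (a (k + 1) + s)) := by gcongr
        _ = _ := by ring
  have hpow : (1 + L * dt) ^ N ≤ ε ^ (-C) := by
    have h1 : 1 + L * dt ≤ Real.exp (L * dt) := by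
      linarith [Real.add_one_le_exp (L * dt)]
    have h2 : (N : ℝ) * (L * dt) = Real.log ε * (-C) := by
      have : (N : ℝ) * (L * dt) = L * (N * dt) := by ring
      rw [this, hT, one_div, Real.log_inv]
      field_simp
    calc (1 + L * dt) ^ N ≤ Real.exp (L * dt) ^ N := by gcongr
      _ = ε ^ (-C) := by rw [← Real.exp_nat_mul, h2, Real.rpow_def_of_pos hε0]
  have hN := key N le_rfl
  have haN0 := ha N le_rfl
  have hfin : (1 + L * dt) ^ N * (a N + s) ≤ ε ^ (-C) * (E + s) := by
    gcongr
  have he : ε ^ (-C) * s = (Real.sqrt 2 / L) * ε ^ (1 - C) := by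
    rw [sub_eq_add_neg, Real.rpow_add hε0, Real.rpow_one, hs]; ring
  rw [← he]
  linarith
end

section
/- Time reversal of the general Fokker–Planck equation: let N ≥ 1, T > 0, let f : ℝ^N → ℝ^N and Σ : ℝ^N → (ℝ^N → ℝ^N) (an N×N matrix field, components Σ_{ij}) be twice continuously differentiable, and let p : ℝ^N × ℝ → ℝ be strictly positive, twice continuously differentiable in the space variable and once in time, satisfying the forward Fokker–Planck equation ∂_t p = −Σ_i ∂_i (f_i p) + (1/2)·Σ_{i,j} ∂_i ∂_j (Σ_{ij} p) on ℝ^N × [0,T]. Define q(z, t̃) = p(z, T − t̃). Then for all (z, t̃) ∈ ℝ^N × [0,T], q satisfies the reverse Fokker–Planck equation ∂_{t̃} q = −Σ_i ∂_i [ ( −f_i + Σ_j ∂_j Σ_{ij} + Σ_j Σ_{ij} ∂_j log p(·, T − t̃) ) · q ] + (1/2)·Σ_{i,j} ∂_i ∂_j (Σ_{ij} q). -/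
/-!
STATEMENT 12: time reversal of the general Fokker–Planck equation: if p > 0 solves
∂_t p = −Σ_i ∂_i(f_i p) + (1/2)Σ_{ij} ∂_i∂_j(Σ_{ij} p) on ℝ^N × [0,T], then
q(z,t̃) = p(z,T−t̃) solves the reverse Fokker–Planck equation with score drift
−f + ∇·Σ + Σ·∇log p.
-/

/-- Partial derivative in the `i`-th coordinate direction. -/
noncomputable def pd {N : ℕ} (i : Fin N) (F : (Fin N → ℝ) → ℝ) : (Fin N → ℝ) → ℝ :=
  fun z => fderiv ℝ F z (Pi.single i 1)

lemma pd_mul_aux {N : ℕ} (j : Fin N) (a b : (Fin N → ℝ) → ℝ) (z : Fin N → ℝ)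
    (ha : DifferentiableAt ℝ a z) (hb : DifferentiableAt ℝ b z) :
    pd j (fun y => a y * b y) z = a z * pd j b z + pd j a z * b z := by
  unfold pd
  rw [fderiv_fun_mul ha hb]
  simp [mul_comm]

lemma pd_log_aux {N : ℕ} (j : Fin N) (b : (Fin N → ℝ) → ℝ) (z : Fin N → ℝ)
    (hb : DifferentiableAt ℝ b z) (h : b z ≠ 0) :
    pd j (fun y => Real.log (b y)) z * b z = pd j b z := by
  unfold pd
  rw [fderiv.log hb h]
  simp
  field_simp

lemma pd_diff_aux {N : ℕ} (j : Fin N) (b : (Fin N → ℝ) → ℝ) (hb : ContDiff ℝ 2 b) :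
    Differentiable ℝ (pd j b) := by
  have h : ContDiff ℝ 1 (fderiv ℝ b) := hb.fderiv_right (by norm_num)
  have h2 : ContDiff ℝ 1 (fun z => fderiv ℝ b z (Pi.single j 1)) := h.clm_apply contDiff_const
  exact h2.differentiable (by norm_num)

theorem reverse_fokker_planck (N : ℕ) (hN : 1 ≤ N) (T : ℝ) (hT : 0 < T)
    (f : (Fin N → ℝ) → Fin N → ℝ) (Sig : (Fin N → ℝ) → Fin N → Fin N → ℝ)
    (hf : ∀ i, ContDiff ℝ 2 (fun z => f z i))
    (hSig : ∀ i j, ContDiff ℝ 2 (fun z => Sig z i j))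
    (p : (Fin N → ℝ) → ℝ → ℝ)
    (hp_pos : ∀ z t, 0 < p z t)
    (hp_space : ∀ t, ContDiff ℝ 2 (fun z => p z t))
    (hp_time : ∀ z, ContDiff ℝ 1 (fun t => p z t))
    (hFP : ∀ z : Fin N → ℝ, ∀ t ∈ Set.Icc (0 : ℝ) T,
      deriv (fun s => p z s) t
        = -∑ i, pd i (fun y => f y i * p y t) z
          + (1 / 2) * ∑ i, ∑ j, pd i (pd j (fun y => Sig y i j * p y t)) z) :
    ∀ z : Fin N → ℝ, ∀ t' ∈ Set.Icc (0 : ℝ) T,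
      deriv (fun s => p z (T - s)) t'
        = -∑ i, pd i (fun y =>
              (-(f y i) + (∑ j, pd j (fun y' => Sig y' i j) y)
                + ∑ j, Sig y i j * pd j (fun y' => Real.log (p y' (T - t'))) y)
              * p y (T - t')) z
          + (1 / 2) * ∑ i, ∑ j, pd i (pd j (fun y => Sig y i j * p y (T - t'))) z := by
  intro z t' ht
  have hT' : T - t' ∈ Set.Icc (0 : ℝ) T := ⟨by linarith [ht.2], by linarith [ht.1]⟩
  have h1 : deriv (fun s => p z (T - s)) t' = -deriv (fun s => p z s) (T - t') :=
    deriv_comp_const_sub (f := fun s => p z s) T t'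
  rw [h1, hFP z _ hT']
  generalize T - t' = τ at *
  have hq := hp_space τ
  have hqd : Differentiable ℝ (fun y => p y τ) := hq.differentiable (by norm_num)
  have key : ∀ i, pd i (fun y =>
              (-(f y i) + (∑ j, pd j (fun y' => Sig y' i j) y)
                + ∑ j, Sig y i j * pd j (fun y' => Real.log (p y' τ)) y) * p y τ) z
      = -pd i (fun y => f y i * p y τ) z
        + ∑ j, pd i (pd j (fun y => Sig y i j * p y τ)) z := by
    intro i
    have e : (fun y => (-(f y i) + (∑ j, pd j (fun y' => Sig y' i j) y)
                + ∑ j, Sig y i j * pd j (fun y' => Real.log (p y' τ)) y) * p y τ)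
        = fun y => -(f y i * p y τ) + ∑ j, pd j (fun y' => Sig y' i j * p y' τ) y := by
      funext y
      rw [add_assoc, ← Finset.sum_add_distrib, add_mul, Finset.sum_mul, neg_mul]
      congr 1
      refine Finset.sum_congr rfl fun j _ => ?_
      rw [pd_mul_aux j _ _ y ((hSig i j).differentiable (by norm_num) y) (hqd y),
        ← pd_log_aux j (fun y' => p y' τ) y (hqd y) (hp_pos y τ).ne']
      ring
    rw [e]
    have d1 : DifferentiableAt ℝ (fun y => f y i * p y τ) z :=
      (((hf i).mul hq).differentiable (by norm_num)) z
    have d2 : ∀ j ∈ Finset.univ,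
        DifferentiableAt ℝ (pd j (fun y' => Sig y' i j * p y' τ)) z :=
      fun j _ => pd_diff_aux j _ ((hSig i j).mul hq) z
    conv_lhs => unfold pd
    change fderiv ℝ (fun y => -(f y i * p y τ)
      + ∑ j, pd j (fun y' => Sig y' i j * p y' τ) y) z (Pi.single i 1) = _
    rw [fderiv_fun_add d1.fun_neg (DifferentiableAt.fun_sum d2), fderiv_fun_neg,
      fderiv_fun_sum d2]
    simp [pd]
  simp only [key, Finset.sum_add_distrib, Finset.sum_neg_distrib]
  ring
end

section
/- Probability-flow identity: let N ≥ 1, let f : ℝ^N → ℝ^N be continuously differentiable, Σ : ℝ^N → (ℝ^N → ℝ^N) (components Σ_{ij}) be twice continuously differentiable, and p : ℝ^N → ℝ be strictly positive and twice continuously differentiable. Define the velocity field v_i = f_i − (1/2)·( Σ_j ∂_j Σ_{ij} + Σ_j Σ_{ij} ∂_j log p ). Then pointwise on ℝ^N: −Σ_i ∂_i (v_i · p) = −Σ_i ∂_i (f_i · p) + (1/2)·Σ_{i,j} ∂_i ∂_j (Σ_{ij} · p). Consequently, p(·,t) solves the Fokker–Planck equation ∂_t p = −∇·(fp) + (1/2)∂_i∂_j(Σ_{ij}p)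 if and only if it solves the continuity equation ∂_t p = −∇·(vp) with the probability-flow velocity v. -/
theorem probability_flow_identity (N : ℕ) (hN : 1 ≤ N)
    (f : (Fin N → ℝ) → Fin N → ℝ) (Sig : (Fin N → ℝ) → Fin N → Fin N → ℝ)
    (hf : ∀ i, ContDiff ℝ 1 (fun z => f z i))
    (hSig : ∀ i j, ContDiff ℝ 2 (fun z => Sig z i j))
    (p : (Fin N → ℝ) → ℝ)
    (hp_pos : ∀ z, 0 < p z)
    (hp : ContDiff ℝ 2 p) :
    ∀ z : Fin N → ℝ,
      -∑ i, pd i (fun y =>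
          (f y i - (1 / 2) * ((∑ j, pd j (fun y' => Sig y' i j) y)
            + ∑ j, Sig y i j * pd j (fun y' => Real.log (p y')) y)) * p y) z
        = -∑ i, pd i (fun y => f y i * p y) z
          + (1 / 2) * ∑ i, ∑ j, pd i (pd j (fun y => Sig y i j * p y)) z := by
  intro z
  have hpd : Differentiable ℝ p := hp.differentiable (by norm_num)
  have hSd : ∀ i j, Differentiable ℝ (fun y => Sig y i j) := fun i j =>
    (hSig i j).differentiable (by norm_num)
  -- the probability flux, rewritten
  have hflux : ∀ i, (fun y =>
          (f y i - (1 / 2) * ((∑ j, pd j (fun y' => Sig y' i j) y)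
            + ∑ j, Sig y i j * pd j (fun y' => Real.log (p y')) y)) * p y)
      = fun y => f y i * p y - (1 / 2) * ∑ j, pd j (fun y => Sig y i j * p y) y := by
    intro i
    funext y
    have hne : p y ≠ 0 := (hp_pos y).ne'
    have hlog : ∀ j, pd j (fun y' => Real.log (p y')) y = (p y)⁻¹ * pd j p y := by
      intro j
      unfold pd
      rw [((hpd y).hasFDerivAt.log hne).fderiv]
      simp
    have hmul : ∀ j, pd j (fun y => Sig y i j * p y) y
        = pd j (fun y' => Sig y' i j) y * p y
          + Sig y i j * pd j (fun y' => Real.log (p y')) y * p y := by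
      intro j
      rw [hlog]
      unfold pd
      rw [((hSd i j y).hasFDerivAt.fun_mul (hpd y).hasFDerivAt).fderiv]
      simp
      field_simp
      ring
    rw [Finset.sum_congr rfl (fun j _ => hmul j), Finset.sum_add_distrib,
      ← Finset.sum_mul, ← Finset.sum_mul]
    ring
  have hdiff : ∀ i j, Differentiable ℝ (pd j (fun y => Sig y i j * p y)) := by
    intro i j
    have h1 : ContDiff ℝ 1 (fderiv ℝ (fun y => Sig y i j * p y)) :=
      ((hSig i j).mul hp).fderiv_right (by norm_num)
    exact (h1.differentiable (by norm_num)).clm_apply (differentiable_const _)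
  have hfp : ∀ i, Differentiable ℝ (fun y => f y i * p y) := fun i =>
    ((hf i).differentiable (by norm_num)).mul hpd
  have hmain : ∀ i, pd i (fun y =>
        f y i * p y - (1 / 2) * ∑ j, pd j (fun y => Sig y i j * p y) y) z
      = pd i (fun y => f y i * p y) z
        - (1 / 2) * ∑ j, pd i (pd j (fun y => Sig y i j * p y)) z := by
    intro i
    have hs : HasFDerivAt (fun y => ∑ j, pd j (fun y => Sig y i j * p y) y)
        (∑ j, fderiv ℝ (pd j (fun y => Sig y i j * p y)) z) z :=
      HasFDerivAt.fun_sum (fun j _ => (hdiff i j z).hasFDerivAt)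
    have h := (hfp i z).hasFDerivAt.fun_sub (hs.const_mul (1 / 2 : ℝ))
    have e : ∀ F : (Fin N → ℝ) → ℝ, pd i F z = fderiv ℝ F z (Pi.single i 1) := fun _ => rfl
    rw [e, h.fderiv]
    simp [e]
  rw [Finset.sum_congr rfl (fun i _ => (congrArg (fun F => pd i F z) (hflux i)).trans (hmain i)),
    Finset.sum_sub_distrib, ← Finset.mul_sum]
  ring
end
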